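/- Let Λ be a right coherent ring (i.e. every finitely generated right ideal of Λ is finitely presented; equivalently the category mod Λ of finitely presented right Λ-modules is abelian). Then an object X of the derived category D(Λ) of all right Λ-modules is homologically perfect (with respect to taking degree-zero cohomology) if and only if X has finitely presented cohomology modules HⁿX in every degree and HⁿX = 0 for all but finitely many n, i.e. X lies in the image of the canonical full embedding of D^b(mod Λ) into D(Λ). -/

import Mathlib

/-!
STATEMENT 18: Let `Λ` be a right coherent ring (every finitely generated ideal is
finitely presented).  An object `X` of the derived category `D(Λ)` is homologically
perfect (with respect to degree-zero cohomology) iff all its cohomology modules are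
finitely presented and almost all vanish, i.e. `X` lies in (the image of) `D^b(mod Λ)`.
-/

open CategoryTheory CategoryTheory.Limits CategoryTheory.Pretriangulated

universe u

namespace SeqCompletion

variable (Λ : Type u) [Ring Λ] [HasDerivedCategory (ModuleCat.{u} Λ)]

/-- An object of the derived category is perfect if it is isomorphic to a bounded
complex of finitely generated projective modules. -/
def IsPerfectObj (X : DerivedCategory (ModuleCat.{u} Λ)) : Prop :=
  ∃ P : CochainComplex (ModuleCat.{u} Λ) ℤ,
    (∀ n : ℤ, Module.Finite Λ (P.X n) ∧ Module.Projective Λ (P.X n)) ∧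
    (∃ N : ℕ, ∀ n : ℤ, (N : ℤ) ≤ |n| → Limits.IsZero (P.X n)) ∧
    Nonempty (DerivedCategory.Q.obj P ≅ X)

/-- The morphism `id - φ : c.pt ⟶ c.pt` for a coproduct cofan `c` on a sequence `Xs`. -/
noncomputable def oneSubShiftCofan {D : Type*} [Category D] [Preadditive D]
    (Xs : ℕ ⥤ D) (c : Cofan Xs.obj) (hc : IsColimit c) : c.pt ⟶ c.pt :=
  𝟙 c.pt - (show c.pt ⟶ c.pt from hc.desc (Cofan.mk c.pt
    (fun i => Xs.map (homOfLE (Nat.le_succ i)) ≫ c.inj (i + 1))))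

/-- `X` is homologically perfect: it is the homotopy colimit of a sequence of perfect
complexes satisfying (HP1), (HP2) and (HP3). -/
noncomputable def HomologicallyPerfect (X : DerivedCategory (ModuleCat.{u} Λ)) : Prop :=
  ∃ Xs : ℕ ⥤ DerivedCategory (ModuleCat.{u} Λ),
    (∀ i : ℕ, IsPerfectObj Λ (Xs.obj i)) ∧
    ∃ (c : Cofan Xs.obj) (hc : IsColimit c) (π : c.pt ⟶ X) (δ : X ⟶ c.pt⟦(1 : ℤ)⟧),
      (Triangle.mk (oneSubShiftCofan Xs c hc) π δ
        ∈ distTriang (DerivedCategory (ModuleCat.{u} Λ))) ∧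
      -- (HP1): the sequence is a Cauchy sequence with respect to perfect complexes
      (∀ C : DerivedCategory (ModuleCat.{u} Λ), IsPerfectObj Λ C →
        ∃ N : ℕ, ∀ i : ℕ, N ≤ i →
          Function.Bijective
            (fun g : C ⟶ Xs.obj i => g ≫ Xs.map (homOfLE (Nat.le_succ i)))) ∧
      -- (HP2): the cohomology stabilizes in each degree
      (∀ n : ℤ, ∃ N : ℕ, ∀ i : ℕ, N ≤ i →
        IsIso ((DerivedCategory.homologyFunctor (ModuleCat.{u} Λ) n).map
          (Xs.map (homOfLE (Nat.le_succ i))))) ∧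
      -- (HP3): for almost all degrees the cohomology eventually vanishes
      (∃ M : ℕ, ∀ n : ℤ, (M : ℤ) ≤ |n| → ∃ N : ℕ, ∀ i : ℕ, N ≤ i →
        Limits.IsZero ((DerivedCategory.homologyFunctor (ModuleCat.{u} Λ) n).obj (Xs.obj i)))

section coh
variable {Λ : Type u} [Ring Λ]

lemma coh_pi (hcoh : ∀ I : Submodule Λ Λ, I.FG → Module.FinitePresentation Λ I) (n : ℕ) :
    ∀ N : Submodule Λ (Fin n → Λ), N.FG → Module.FinitePresentation Λ N := by
  induction n with
  | zero => intro N _; infer_instance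
  | succ n ih =>
    intro N hN
    let p : (Fin (n+1) → Λ) →ₗ[Λ] Λ := LinearMap.proj 0
    let f : N →ₗ[Λ] N.map p := p.restrict (fun x hx => Submodule.mem_map_of_mem hx)
    have hf : Function.Surjective f := by
      rintro ⟨y, x, hx, rfl⟩
      exact ⟨⟨x, hx⟩, rfl⟩
    have : Module.Finite Λ N := Module.Finite.iff_fg.mpr hN
    have := hcoh (N.map p) (hN.map p)
    have hk : (LinearMap.ker f).FG := Module.FinitePresentation.fg_ker f hf
    let t : (Fin (n+1) → Λ) →ₗ[Λ] (Fin n → Λ) := LinearMap.funLeft Λ Λ Fin.succ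
    let g : LinearMap.ker f →ₗ[Λ] (Fin n → Λ) := t ∘ₗ N.subtype ∘ₗ (LinearMap.ker f).subtype
    have hg : Function.Injective g := by
      intro x y h
      apply Subtype.ext
      apply Subtype.ext
      funext i
      refine Fin.cases ?_ (fun i => ?_) i
      · have hx := x.2
        have hy := y.2
        rw [LinearMap.mem_ker] at hx hy
        have hx' := congrArg Subtype.val hx
        have hy' := congrArg Subtype.val hy
        exact hx'.trans hy'.symm
      · exact congrFun h i
    have : Module.Finite Λ (LinearMap.ker f) := Module.Finite.iff_fg.mpr hk
    have := ih (LinearMap.range g) (Module.Finite.iff_fg.mp inferInstance)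
    have : Module.FinitePresentation Λ (LinearMap.ker f) :=
      (LinearEquiv.ofInjective (M := LinearMap.ker f) g hg).symm.finitePresentation_iff
        (R := Λ) (M := LinearMap.range g) (N := LinearMap.ker f) |>.mp this
    exact Module.finitePresentation_of_ker f hf

lemma coh_proj (hcoh : ∀ I : Submodule Λ Λ, I.FG → Module.FinitePresentation Λ I)
    {M : Type u} [AddCommGroup M] [Module Λ M] [Module.Finite Λ M] [Module.Projective Λ M]
    (N : Submodule Λ M) (hN : N.FG) : Module.FinitePresentation Λ N := by
  obtain ⟨n, f, hf⟩ := Module.Finite.exists_fin' Λ M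
  obtain ⟨s, hs⟩ := Module.projective_lifting_property f LinearMap.id hf
  have hsi : Function.Injective s := by
    intro x y h
    have := congrArg f h
    rwa [← LinearMap.comp_apply, ← LinearMap.comp_apply, hs] at this
  have := coh_pi hcoh n (N.map s) (hN.map s)
  exact Module.FinitePresentation.of_equiv (Submodule.equivMapOfInjective s hsi N).symm

lemma coh_ker (hcoh : ∀ I : Submodule Λ Λ, I.FG → Module.FinitePresentation Λ I)
    {M M' : Type u} [AddCommGroup M] [Module Λ M] [Module.Finite Λ M]
    [AddCommGroup M'] [Module Λ M'] [Module.Finite Λ M'] [Module.Projective Λ M']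
    (f : M →ₗ[Λ] M') : (LinearMap.ker f).FG := by
  have := coh_proj hcoh (LinearMap.range f) (Module.Finite.iff_fg.mp inferInstance)
  have := Module.FinitePresentation.fg_ker f.rangeRestrict f.surjective_rangeRestrict
  rwa [LinearMap.ker_rangeRestrict] at this

lemma coh_homology (hcoh : ∀ I : Submodule Λ Λ, I.FG → Module.FinitePresentation Λ I)
    (S : ShortComplex (ModuleCat.{u} Λ))
    [Module.Finite Λ S.X₁] [Module.Finite Λ S.X₂] [Module.Projective Λ S.X₂]
    [Module.Finite Λ S.X₃] [Module.Projective Λ S.X₃] :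
    Module.FinitePresentation Λ S.homology := by
  have h1 := coh_ker hcoh S.g.hom
  have := coh_proj hcoh _ h1
  have : Module.FinitePresentation Λ
    (LinearMap.ker S.g.hom ⧸ LinearMap.range S.moduleCatToCycles) :=
    Module.finitePresentation_of_surjective (Submodule.mkQ _) (Submodule.mkQ_surjective _)
      (by rw [Submodule.ker_mkQ]; exact Module.Finite.iff_fg.mp inferInstance)
  exact S.moduleCatHomologyIso.toLinearEquiv.finitePresentation_iff.mpr this

end coh

section coprod
variable {Λ : Type u} [Ring Λ]

lemma span_cofan {A : ℕ → ModuleCat.{u} Λ} (c : Cofan A) (hc : IsColimit c) :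
    (⨆ i, LinearMap.range (c.inj i).hom : Submodule Λ c.pt) = ⊤ := by
  set S := (⨆ i, LinearMap.range (c.inj i).hom : Submodule Λ c.pt) with hS
  have : ModuleCat.ofHom S.mkQ = 0 := by
    refine Cofan.IsColimit.hom_ext hc _ _ (fun i => ?_)
    ext x
    have : (c.inj i).hom x ∈ S := by
      rw [hS]
      exact Submodule.mem_iSup_of_mem i ⟨x, rfl⟩
    simpa using this
  have h2 : S.mkQ = 0 := by simpa using congrArg ModuleCat.Hom.hom this
  rw [← Submodule.ker_mkQ S, h2, LinearMap.ker_zero]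

open HomologicalComplex

/-- elements of homology lift to cycles -/
lemma exists_rep (K : CochainComplex (ModuleCat.{u} Λ) ℤ) (n : ℤ) (x : K.homology n) :
    ∃ z : K.cycles n, (K.homologyπ n).hom z = x :=
  (ModuleCat.epi_iff_surjective (K.homologyπ n)).mp inferInstance x

section proj
open Classical in
/-- The projections of a coproduct in a category with zero morphisms. -/
noncomputable def cproj {D : Type*} [Category D] [HasZeroMorphisms D] {K : ℕ → D}
    {c : Cofan K} (hc : IsColimit c) (j : ℕ) : c.pt ⟶ K j :=
  Cofan.IsColimit.desc hc (fun i => if h : i = j then eqToHom (by rw [h]) else 0)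

variable {D : Type*} [Category D] [HasZeroMorphisms D] {K : ℕ → D}
    {c : Cofan K} (hc : IsColimit c)

lemma inj_cproj (j : ℕ) : c.inj j ≫ cproj hc j = 𝟙 _ := by simp [cproj]

lemma inj_cproj_ne (i j : ℕ) (h : i ≠ j) : c.inj i ≫ cproj hc j = 0 := by simp [cproj, h]

lemma inj_cproj_assoc (j : ℕ) {Z : D} (g : K j ⟶ Z) : c.inj j ≫ cproj hc j ≫ g = g := by
  rw [← Category.assoc, inj_cproj, Category.id_comp]

lemma inj_cproj_ne_assoc (i j : ℕ) (h : i ≠ j) {Z : D} (g : K j ⟶ Z) :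
    c.inj i ≫ cproj hc j ≫ g = 0 ≫ g := by
  rw [← Category.assoc, inj_cproj_ne _ _ _ h]

end proj

lemma mem_iSup_rep {A : ℕ → Type*} {M : Type*} [∀ i, AddCommGroup (A i)] [∀ i, Module Λ (A i)]
    [AddCommGroup M] [Module Λ M] (f : ∀ i, A i →ₗ[Λ] M) (p : ∀ i, M →ₗ[Λ] A i)
    (h1 : ∀ i x, p i (f i x) = x) (h2 : ∀ i j x, i ≠ j → p j (f i x) = 0)
    (h : (⨆ i, LinearMap.range (f i)) = ⊤) (x : M) :
    ∃ s : Finset ℕ, x = ∑ i ∈ s, f i (p i x) := by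
  classical
  suffices H : ∃ s : Finset ℕ, ∀ t, s ⊆ t → x = ∑ i ∈ t, f i (p i x) by
    obtain ⟨s, hs⟩ := H
    exact ⟨s, hs s subset_rfl⟩
  have hx : x ∈ (⨆ i, LinearMap.range (f i)) := by rw [h]; trivial
  induction hx using Submodule.iSup_induction' with
  | mem i x hx =>
    obtain ⟨y, rfl⟩ := hx
    refine ⟨{i}, fun t ht => ?_⟩
    rw [Finset.sum_eq_single_of_mem i (ht (by simp)), h1]
    intro j _ hj
    rw [h2 _ _ _ hj.symm, map_zero]
  | zero => exact ⟨∅, by simp⟩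
  | add x y _ _ hx hy =>
    obtain ⟨s, hs⟩ := hx
    obtain ⟨s', hs'⟩ := hy
    refine ⟨s ∪ s', fun t ht => ?_⟩
    simp only [map_add, Finset.sum_add_distrib]
    rw [← hs t (Finset.union_subset_left ht), ← hs' t (Finset.union_subset_right ht)]

lemma span_homology {K : ℕ → CochainComplex (ModuleCat.{u} Λ) ℤ} {c : Cofan K}
    (hc : IsColimit c) (n : ℤ) (x : c.pt.homology n) :
    ∃ s : Finset ℕ, x = ∑ i ∈ s, (homologyMap (c.inj i) n).hom
      ((homologyMap (cproj hc i) n).hom x) := by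
  have hX := span_cofan (Cofan.mk (c.pt.X n) (fun i => (c.inj i).f n) : Cofan (fun i => (K i).X n))
    ((isColimitCofanMkObjOfIsColimit (eval _ _ n) _ _ 
      (IsColimit.ofIsoColimit hc (Cofan.ext (Iso.refl _) (by simp)))))
  obtain ⟨z, rfl⟩ := exists_rep _ _ x
  obtain ⟨s, hs⟩ := mem_iSup_rep (fun i => ((c.inj i).f n).hom)
    (fun i => ((cproj hc i).f n).hom)
    (fun i x => by
      have := congrArg (fun f => (f.f n).hom x) (inj_cproj hc i)
      simpa using this)
    (fun i j x hij => by
      have := congrArg (fun f => (f.f n).hom x) (inj_cproj_ne hc i j hij)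
      simpa using this) hX ((c.pt.iCycles n).hom z)
  have key : z = ∑ i ∈ s, (cyclesMap (c.inj i) n).hom ((cyclesMap (cproj hc i) n).hom z) := by
    apply (ModuleCat.mono_iff_injective (c.pt.iCycles n)).mp inferInstance
    refine hs.trans ?_
    rw [map_sum]
    refine Finset.sum_congr rfl (fun i _ => ?_)
    have := congrArg (fun f => f.hom z) (show (cyclesMap (cproj hc i) n ≫ cyclesMap (c.inj i) n)
      ≫ c.pt.iCycles n = c.pt.iCycles n ≫ (cproj hc i).f n ≫ (c.inj i).f n by simp)
    exact this.symm
  refine ⟨s, ?_⟩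
  conv_lhs => rw [key]
  rw [map_sum]
  refine Finset.sum_congr rfl (fun i _ => ?_)
  have := congrArg (fun f => f.hom z) (show (cyclesMap (cproj hc i) n ≫ cyclesMap (c.inj i) n)
      ≫ c.pt.homologyπ n = c.pt.homologyπ n ≫ homologyMap (cproj hc i) n ≫ 
      homologyMap (c.inj i) n by simp)
  exact this

lemma quasiIso_coprod {K L : ℕ → CochainComplex (ModuleCat.{u} Λ) ℤ} {c : Cofan K} {c' : Cofan L}
    (hc : IsColimit c) (hc' : IsColimit c') (s : ∀ i, K i ⟶ L i) [∀ i, QuasiIso (s i)]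
    (t : c.pt ⟶ c'.pt) (ht : ∀ i, c.inj i ≫ t = s i ≫ c'.inj i) : QuasiIso t := by
  have ht' (i) : t ≫ cproj hc' i = cproj hc i ≫ s i := by
    refine Cofan.IsColimit.hom_ext hc _ _ (fun j => ?_)
    by_cases h : j = i
    · subst h
      rw [reassoc_of% (ht j), inj_cproj, inj_cproj_assoc, Category.comp_id]
    · rw [reassoc_of% (ht j), inj_cproj_ne _ _ _ h, inj_cproj_ne_assoc _ _ _ h]
      simp
  rw [quasiIso_iff]
  intro n
  rw [quasiIsoAt_iff_isIso_homologyMap]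
  have hn (i) : IsIso (homologyMap (s i) n) := inferInstance
  rw [ConcreteCategory.isIso_iff_bijective]
  constructor
  · rw [injective_iff_map_eq_zero]
    intro x hx
    have hx0 : (homologyMap t n).hom x = 0 := hx
    obtain ⟨f, hf⟩ := span_homology hc n x
    rw [hf]
    refine Finset.sum_eq_zero (fun i _ => ?_)
    have h1 : (homologyMap (s i) n).hom ((homologyMap (cproj hc i) n).hom x) = 0 := by
      have := congrArg (fun f : c.pt ⟶ L i => (homologyMap f n).hom x) (ht' i)
      simp only [homologyMap_comp, ModuleCat.hom_comp, LinearMap.comp_apply, hx0, map_zero] at this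
      exact this.symm
    have h2 : (homologyMap (cproj hc i) n).hom x = 0 := by
      apply ((ConcreteCategory.isIso_iff_bijective _).mp (hn i)).1
      exact h1.trans (map_zero _).symm
    rw [h2, map_zero]
  · intro y
    obtain ⟨f, hf⟩ := span_homology hc' n y
    refine ⟨∑ i ∈ f, (homologyMap (c.inj i) n).hom ((inv (homologyMap (s i) n)).hom
      ((homologyMap (cproj hc' i) n).hom y)), ?_⟩
    refine (map_sum (homologyMap t n).hom _ _).trans ?_
    conv_rhs => rw [hf]
    refine Finset.sum_congr rfl (fun i _ => ?_)
    have := congrArg (fun f => (homologyMap f n)) (ht i)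
    simp only [homologyMap_comp] at this
    have h2 : inv (homologyMap (s i) n) ≫ homologyMap (c.inj i) n ≫ homologyMap t n =
      homologyMap (c'.inj i) n := by rw [this]; simp
    exact congrArg (fun f => f.hom ((homologyMap (cproj hc' i) n).hom y)) h2

end coprod

section derived
variable {Λ : Type u} [Ring Λ] [HasDerivedCategory (ModuleCat.{u} Λ)]

/-- abbreviation for the homology functor -/
noncomputable abbrev HH (n : ℤ) : DerivedCategory (ModuleCat.{u} Λ) ⥤ ModuleCat.{u} Λ :=
  DerivedCategory.homologyFunctor (ModuleCat.{u} Λ) n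

lemma HH_comp_apply (n : ℤ) {X Y Z : DerivedCategory (ModuleCat.{u} Λ)} (f : X ⟶ Y) (g : Y ⟶ Z)
    (x : (HH n).obj X) :
    ((HH n).map (f ≫ g)).hom x = ((HH n).map g).hom (((HH n).map f).hom x) := by
  rw [Functor.map_comp]; rfl

lemma HH_id_apply (n : ℤ) {X : DerivedCategory (ModuleCat.{u} Λ)} (x : (HH n).obj X) :
    ((HH n).map (𝟙 X)).hom x = x := by
  rw [CategoryTheory.Functor.map_id]; rfl

lemma HH_zero_apply (n : ℤ) {X Y : DerivedCategory (ModuleCat.{u} Λ)} (x : (HH n).obj X) :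
    ((HH n).map (0 : X ⟶ Y)).hom x = 0 := by
  rw [Functor.map_zero]; rfl

lemma HH_sub_apply (n : ℤ) {X Y : DerivedCategory (ModuleCat.{u} Λ)} (f g : X ⟶ Y)
    (x : (HH n).obj X) :
    ((HH n).map (f - g)).hom x = ((HH n).map f).hom x - ((HH n).map g).hom x := by
  rw [Functor.map_sub]; rfl

lemma HH_iso_bij (n : ℤ) {X Y : DerivedCategory (ModuleCat.{u} Λ)} (f : X ⟶ Y) :
    IsIso ((HH n).map f) ↔ Function.Bijective ((HH n).map f).hom :=
  ConcreteCategory.isIso_iff_bijective _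

open DerivedCategory

section les
variable {X Y Z : DerivedCategory (ModuleCat.{u} Λ)} {f : X ⟶ Y} {g : Y ⟶ Z} {h : Z ⟶ X⟦(1 : ℤ)⟧}
  (hT : Triangle.mk f g h ∈ distTriang (DerivedCategory (ModuleCat.{u} Λ)))

/-- the connecting map -/
noncomputable def dl (f : X ⟶ Y) (g : Y ⟶ Z) (h : Z ⟶ X⟦(1 : ℤ)⟧) (n m : ℤ) (hnm : n + 1 = m) :
    (HH n).obj Z ⟶ (HH m).obj X :=
  HomologySequence.δ (Triangle.mk f g h) n m hnm

include hT

lemma les2 (n : ℤ) (y : (HH n).obj Y) (hy : ((HH n).map g).hom y = 0) :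
    ∃ x : (HH n).obj X, ((HH n).map f).hom x = y :=
  (ShortComplex.moduleCat_exact_iff _).mp (HomologySequence.exact₂ _ hT n) y hy

lemma les3 (n m : ℤ) (hnm : n + 1 = m) (z : (HH n).obj Z) (hz : (dl f g h n m hnm).hom z = 0) :
    ∃ y : (HH n).obj Y, ((HH n).map g).hom y = z :=
  (ShortComplex.moduleCat_exact_iff _).mp (HomologySequence.exact₃ _ hT n m hnm) z hz

lemma les1 (n m : ℤ) (hnm : n + 1 = m) (x : (HH m).obj X) (hx : ((HH m).map f).hom x = 0) :
    ∃ z : (HH n).obj Z, (dl f g h n m hnm).hom z = x :=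
  (ShortComplex.moduleCat_exact_iff _).mp (HomologySequence.exact₁ _ hT n m hnm) x hx

lemma les_z2 (n : ℤ) (x : (HH n).obj X) : ((HH n).map g).hom (((HH n).map f).hom x) = 0 := by
  have : f ≫ g = 0 := comp_distTriang_mor_zero₁₂ _ hT
  rw [← HH_comp_apply, this, HH_zero_apply]

lemma les_z3 (n m : ℤ) (hnm : n + 1 = m) (y : (HH n).obj Y) :
    (dl f g h n m hnm).hom (((HH n).map g).hom y) = 0 :=
  congrArg (fun k => k.hom y) (HomologySequence.comp_δ _ hT n m hnm)

lemma les_z1 (n m : ℤ) (hnm : n + 1 = m) (z : (HH n).obj Z) :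
    ((HH m).map f).hom ((dl f g h n m hnm).hom z) = 0 :=
  congrArg (fun k => k.hom z) (HomologySequence.δ_comp _ hT n m hnm)

end les

lemma Q_span {K : ℕ → CochainComplex (ModuleCat.{u} Λ) ℤ} {c : Cofan K}
    (hc : IsColimit c) (n : ℤ) (x : (HH n).obj (Q.obj c.pt)) :
    ∃ s : Finset ℕ, x = ∑ i ∈ s, ((HH n).map (Q.map (c.inj i))).hom
      (((HH n).map (Q.map (cproj hc i))).hom x) := by
  let e (L : CochainComplex (ModuleCat.{u} Λ) ℤ) := (homologyFunctorFactors (ModuleCat.{u} Λ) n).app L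
  obtain ⟨s, hs⟩ := span_homology hc n ((e _).hom.hom x)
  refine ⟨s, ?_⟩
  have inj : Function.Injective (e c.pt).hom.hom :=
    ((ConcreteCategory.isIso_iff_bijective _).mp (inferInstance : IsIso (e c.pt).hom)).1
  apply inj
  rw [hs, map_sum]
  refine Finset.sum_congr rfl (fun i _ => ?_)
  have h : (HH n).map (Q.map (cproj hc i)) ≫ (HH n).map (Q.map (c.inj i)) ≫ (e _).hom =
    (e _).hom ≫ HomologicalComplex.homologyMap (cproj hc i) n ≫
      HomologicalComplex.homologyMap (c.inj i) n := by
    have h1 := homologyFunctorFactors_hom_naturality (c.inj i) n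
    have h2 := homologyFunctorFactors_hom_naturality (cproj hc i) n
    refine (congrArg (fun f => (HH n).map (Q.map (cproj hc i)) ≫ f) h1).trans ?_
    exact (Category.assoc _ _ _).symm.trans ((congrArg (fun f => f ≫ 
      HomologicalComplex.homologyMap (c.inj i) n) h2).trans (Category.assoc _ _ _))
  exact congrArg (fun f => f.hom x) h.symm

lemma Q_coprod_exists {K : ℕ → CochainComplex (ModuleCat.{u} Λ) ℤ} {c : Cofan K}
    (hc : IsColimit c) {Y : DerivedCategory (ModuleCat.{u} Λ)} (f : ∀ i, Q.obj (K i) ⟶ Y) :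
    ∃ g : Q.obj c.pt ⟶ Y, ∀ i, Q.map (c.inj i) ≫ g = f i := by
  let e := Q.objObjPreimageIso Y
  choose K' s hs g hg using fun i => right_fac (f i ≫ e.inv)
  have hs' (i) : QuasiIso (s i) := (isIso_Q_map_iff_quasiIso _ _).mp (hs i)
  let c' : Cofan K' := Cofan.mk (∐ K') (Sigma.ι K')
  let hc' : IsColimit c' := coproductIsCoproduct K'
  let t : c'.pt ⟶ c.pt := Cofan.IsColimit.desc hc' (fun i => s i ≫ c.inj i)
  have ht (i) : c'.inj i ≫ t = s i ≫ c.inj i := Cofan.IsColimit.fac _ _ _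
  let G : c'.pt ⟶ _ := Cofan.IsColimit.desc hc' g
  have hG (i) : c'.inj i ≫ G = g i := Cofan.IsColimit.fac _ _ _
  have := quasiIso_coprod hc' hc s t ht
  refine ⟨inv (Q.map t) ≫ Q.map G ≫ e.hom, fun i => ?_⟩
  have h1 : Q.map (c.inj i) ≫ inv (Q.map t) = inv (Q.map (s i)) ≫ Q.map (c'.inj i) := by
    rw [IsIso.comp_inv_eq, Category.assoc, ← Q.map_comp, ht, Q.map_comp, IsIso.inv_hom_id_assoc]
  rw [reassoc_of% h1, ← Q.map_comp_assoc, hG, ← reassoc_of% (hg i)]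
  simp

lemma Q_coprod_unique {K : ℕ → CochainComplex (ModuleCat.{u} Λ) ℤ} {c : Cofan K}
    (hc : IsColimit c) {Y : DerivedCategory (ModuleCat.{u} Λ)} (f : Q.obj c.pt ⟶ Y)
    (hf : ∀ i, Q.map (c.inj i) ≫ f = 0) : f = 0 := by
  obtain ⟨F, v, w, hT⟩ := distinguished_cocone_triangle₁ f
  choose a ha using fun i => Triangle.coyoneda_exact₂ _ hT (Q.map (c.inj i)) (hf i)
  change ∀ i, _ ⟶ F at a
  change ∀ i, _ = a i ≫ v at ha
  obtain ⟨b, hb⟩ := Q_coprod_exists hc a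
  have hid (n : ℤ) : (HH n).map (b ≫ v) = 𝟙 _ := by
    ext x
    obtain ⟨s, hs⟩ := Q_span hc n x
    rw [hs]
    simp only [map_sum]
    refine Finset.sum_congr rfl (fun i _ => ?_)
    rw [← HH_comp_apply, reassoc_of% (hb i), ← ha]
    rfl
  have : IsIso (b ≫ v) := by
    rw [DerivedCategory.isIso_iff]
    intro n
    have := hid n
    dsimp [HH] at this
    rw [this]
    infer_instance
  have h0 : v ≫ f = 0 := comp_distTriang_mor_zero₁₂ _ hT
  rw [← cancel_epi (b ≫ v), Category.assoc, h0, comp_zero, comp_zero]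

lemma exists_coprod (X : ℕ → DerivedCategory (ModuleCat.{u} Λ)) :
    ∃ (c : Cofan X) (_ : IsColimit c), ∀ n,
      (⨆ i, LinearMap.range ((HH n).map (c.inj i)).hom : Submodule Λ ((HH n).obj c.pt)) = ⊤ := by
  let K (i : ℕ) := Q.objPreimage (X i)
  let e (i : ℕ) : Q.obj (K i) ≅ X i := Q.objObjPreimageIso (X i)
  let c : Cofan K := Cofan.mk (∐ K) (Sigma.ι K)
  let hc : IsColimit c := coproductIsCoproduct K
  refine ⟨Cofan.mk (Q.obj c.pt) (fun i => (e i).inv ≫ Q.map (c.inj i)),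
    Cofan.IsColimit.mk _ (fun t => (Q_coprod_exists hc (fun i => (e i).hom ≫ t.inj i)).choose) ?_ ?_, ?_⟩
  · intro t j
    have := (Q_coprod_exists hc (fun i => (e i).hom ≫ t.inj i)).choose_spec j
    simp only [cofan_mk_inj, Category.assoc, this, Iso.inv_hom_id_assoc]
  · intro t m hm
    rw [← sub_eq_zero]
    apply Q_coprod_unique hc
    intro i
    have := (Q_coprod_exists hc (fun i => (e i).hom ≫ t.inj i)).choose_spec i
    rw [Preadditive.comp_sub, this, ← hm]
    simp
  · intro n
    rw [eq_top_iff]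
    rintro x -
    obtain ⟨s, hs⟩ := Q_span hc n x
    rw [hs]
    refine Submodule.sum_mem _ (fun i _ => Submodule.mem_iSup_of_mem i ?_)
    refine ⟨((HH n).map (e i).hom).hom (((HH n).map (Q.map (cproj hc i))).hom x), ?_⟩
    have h : (e i).hom ≫ (Cofan.mk (Q.obj c.pt) (fun i => (e i).inv ≫ Q.map (c.inj i))).inj i =
        Q.map (c.inj i) := by
      change (e i).hom ≫ (e i).inv ≫ _ = _
      rw [Iso.hom_inv_id_assoc]
    rw [← HH_comp_apply, h]

lemma D_span {X : ℕ → DerivedCategory (ModuleCat.{u} Λ)} {c : Cofan X} (hc : IsColimit c)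
    (n : ℤ) (x : (HH n).obj c.pt) :
    ∃ s : Finset ℕ, x = ∑ i ∈ s, ((HH n).map (c.inj i)).hom
      (((HH n).map (cproj hc i)).hom x) := by
  apply mem_iSup_rep (fun i => ((HH n).map (c.inj i)).hom) (fun i => ((HH n).map (cproj hc i)).hom)
  · intro i x
    rw [← HH_comp_apply, inj_cproj, HH_id_apply]
  · intro i j x h
    rw [← HH_comp_apply, inj_cproj_ne _ _ _ h, HH_zero_apply]
  · obtain ⟨c', hc', h⟩ := exists_coprod X
    let e : c'.pt ≅ c.pt := hc'.coconePointUniqueUpToIso hc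
    have he (i) : c'.inj i ≫ e.hom = c.inj i := hc'.comp_coconePointUniqueUpToIso_hom hc ⟨i⟩
    rw [eq_top_iff]
    rintro x -
    have hx : ((HH n).map e.inv).hom x ∈ (⊤ : Submodule Λ _) := trivial
    rw [← h] at hx
    have := Submodule.mem_map_of_mem (f := ((HH n).map e.hom).hom) hx
    rw [← HH_comp_apply, e.inv_hom_id, HH_id_apply, Submodule.map_iSup] at this
    convert! this using 3 with i
    rw [← he, Functor.map_comp, ModuleCat.hom_comp, LinearMap.range_comp]

section hocolim
variable {Xs : ℕ ⥤ DerivedCategory (ModuleCat.{u} Λ)} {c : Cofan Xs.obj} (hc : IsColimit c)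

lemma inj_oneSub (i : ℕ) : c.inj i ≫ oneSubShiftCofan Xs c hc =
    c.inj i - Xs.map (homOfLE (Nat.le_succ i)) ≫ c.inj (i + 1) := by
  have : c.inj i ≫ hc.desc (Cofan.mk c.pt
    (fun i => Xs.map (homOfLE (Nat.le_succ i)) ≫ c.inj (i + 1))) =
      Xs.map (homOfLE (Nat.le_succ i)) ≫ c.inj (i + 1) := hc.fac _ ⟨i⟩
  rw [oneSubShiftCofan, Preadditive.comp_sub, Category.comp_id]
  exact congrArg _ this

lemma inj_oneSub_assoc (i : ℕ) {Z : DerivedCategory (ModuleCat.{u} Λ)} (g : c.pt ⟶ Z) :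
    c.inj i ≫ oneSubShiftCofan Xs c hc ≫ g =
    (c.inj i - Xs.map (homOfLE (Nat.le_succ i)) ≫ c.inj (i + 1)) ≫ g := by
  rw [← inj_oneSub hc, Category.assoc]

lemma oneSub_cproj_zero : oneSubShiftCofan Xs c hc ≫ cproj hc 0 = cproj hc 0 := by
  refine Cofan.IsColimit.hom_ext hc _ _ (fun i => ?_)
  rw [inj_oneSub_assoc, Preadditive.sub_comp, Category.assoc, inj_cproj_ne _ (i+1) 0 (by simp)]
  simp

lemma oneSub_cproj_succ (j : ℕ) : oneSubShiftCofan Xs c hc ≫ cproj hc (j+1) =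
    cproj hc (j+1) - cproj hc j ≫ Xs.map (homOfLE (Nat.le_succ j)) := by
  refine Cofan.IsColimit.hom_ext hc _ _ (fun i => ?_)
  rw [inj_oneSub_assoc, Preadditive.sub_comp, Category.assoc, Preadditive.comp_sub]
  congr 1
  by_cases h : i = j
  · subst h
    rw [inj_cproj, inj_cproj_assoc, Category.comp_id]
  · rw [inj_cproj_ne _ (i+1) (j+1) (by simpa using h), inj_cproj_ne_assoc _ _ _ h]
    simp

lemma HH_oneSub_zero (n : ℤ) (y : (HH n).obj c.pt) :
    ((HH n).map (cproj hc 0)).hom (((HH n).map (oneSubShiftCofan Xs c hc)).hom y) =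
      ((HH n).map (cproj hc 0)).hom y := by
  rw [← HH_comp_apply, oneSub_cproj_zero]

lemma HH_oneSub_succ (n : ℤ) (y : (HH n).obj c.pt) (j : ℕ) :
    ((HH n).map (cproj hc (j+1))).hom (((HH n).map (oneSubShiftCofan Xs c hc)).hom y) =
      ((HH n).map (cproj hc (j+1))).hom y -
      ((HH n).map (Xs.map (homOfLE (Nat.le_succ j)))).hom (((HH n).map (cproj hc j)).hom y) := by
  rw [← HH_comp_apply, oneSub_cproj_succ, HH_sub_apply, HH_comp_apply]

lemma HH_oneSub_mono (n : ℤ) : Mono ((HH n).map (oneSubShiftCofan Xs c hc)) := by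
  rw [ModuleCat.mono_iff_injective, injective_iff_map_eq_zero]
  intro x hx
  have hx : ((HH n).map (oneSubShiftCofan Xs c hc)).hom x = 0 := hx
  have h (j) : ((HH n).map (cproj hc j)).hom x = 0 := by
    induction j with
    | zero => rw [← HH_oneSub_zero, hx, map_zero]
    | succ j ih =>
      have := HH_oneSub_succ hc n x j
      rw [hx, ih, map_zero, map_zero, sub_zero] at this
      exact this.symm
  obtain ⟨s, hs⟩ := D_span hc n x
  rw [hs]
  exact Finset.sum_eq_zero (fun i _ => by rw [h, map_zero])

variable {X : DerivedCategory (ModuleCat.{u} Λ)}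

lemma inj_comp_pi (π : c.pt ⟶ X) (h : oneSubShiftCofan Xs c hc ≫ π = 0) (i j : ℕ) (hij : i ≤ j) :
    Xs.map (homOfLE hij) ≫ c.inj j ≫ π = c.inj i ≫ π := by
  induction j, hij using Nat.le_induction with
  | base => simp
  | succ j hij ih =>
    have h1 := c.inj j ≫= h
    rw [inj_oneSub_assoc, Preadditive.sub_comp, comp_zero, sub_eq_zero, Category.assoc] at h1
    rw [← ih, h1, ← Xs.map_comp_assoc]
    rfl

lemma isIso_map_le (n : ℤ) (N : ℕ)
    (hN : ∀ i, N ≤ i → IsIso ((HH n).map (Xs.map (homOfLE (Nat.le_succ i))))) (i : ℕ) (hi : N ≤ i) :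
    IsIso ((HH n).map (Xs.map (homOfLE hi))) := by
  induction i, hi using Nat.le_induction with
  | base => simp only [homOfLE_refl, CategoryTheory.Functor.map_id]; infer_instance
  | succ j hij ih =>
    have := hN j hij
    have e : Xs.map (homOfLE (hij.trans (Nat.le_succ j))) =
      Xs.map (homOfLE hij) ≫ Xs.map (homOfLE (Nat.le_succ j)) := by
      rw [← Xs.map_comp]; rfl
    rw [e, Functor.map_comp]
    infer_instance

lemma hocolim_isIso (π : c.pt ⟶ X) (δ : X ⟶ c.pt⟦(1 : ℤ)⟧)
    (hT : Triangle.mk (oneSubShiftCofan Xs c hc) π δ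
        ∈ distTriang (DerivedCategory (ModuleCat.{u} Λ))) (n : ℤ) (N : ℕ)
    (hN : ∀ i, N ≤ i → IsIso ((HH n).map (Xs.map (homOfLE (Nat.le_succ i))))) :
    IsIso ((HH n).map (c.inj N ≫ π)) := by
  have hz : oneSubShiftCofan Xs c hc ≫ π = 0 := comp_distTriang_mor_zero₁₂ _ hT
  have hepi : Function.Surjective ((HH n).map π).hom := by
    have h1 := (HomologySequence.epi_homologyMap_mor₂_iff _ hT n (n+1) rfl).mpr
      ((HomologySequence.mono_homologyMap_mor₁_iff _ hT n (n+1) rfl).mp (HH_oneSub_mono hc (n+1)))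
    exact (ModuleCat.epi_iff_surjective _).mp h1
  rw [HH_iso_bij]
  constructor
  · rw [injective_iff_map_eq_zero]
    intro m hm
    rw [HH_comp_apply] at hm
    obtain ⟨y, hy⟩ := les2 hT n (((HH n).map (c.inj N)).hom m) hm
    have hlt (j) (hj : j < N) : ((HH n).map (cproj hc j)).hom y = 0 := by
      induction j with
      | zero => rw [← HH_oneSub_zero, hy, ← HH_comp_apply, inj_cproj_ne _ _ _ hj.ne', HH_zero_apply]
      | succ j ih =>
        have := HH_oneSub_succ hc n y j
        rw [hy, ih (by omega), map_zero, sub_zero, ← HH_comp_apply, inj_cproj_ne _ _ _ hj.ne',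
          HH_zero_apply] at this
        exact this.symm
    have hNN : ((HH n).map (cproj hc N)).hom y = m := by
      cases N with
      | zero => rw [← HH_oneSub_zero, hy, ← HH_comp_apply, inj_cproj, HH_id_apply]
      | succ j =>
        have := HH_oneSub_succ hc n y j
        rw [hy, hlt j (by omega), map_zero, sub_zero, ← HH_comp_apply, inj_cproj,
          HH_id_apply] at this
        exact this.symm
    have hgt (j) (hj : N ≤ j) : ((HH n).map (cproj hc j)).hom y = 0 → m = 0 := by
      induction j, hj using Nat.le_induction with
      | base => intro h; rw [← hNN, h]
      | succ j hj ih =>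
        intro h
        apply ih
        have := HH_oneSub_succ hc n y j
        rw [hy, h, ← HH_comp_apply, inj_cproj_ne _ N (j+1) (by omega), HH_zero_apply, zero_sub,
          eq_comm, neg_eq_zero] at this
        exact ((HH_iso_bij _ _).mp (hN j hj)).1 (this.trans (map_zero _).symm)
    obtain ⟨s, hs⟩ := D_span hc n y
    obtain ⟨j, hj⟩ : ∃ j, j ∉ s ∧ N ≤ j :=
      ⟨N + s.sup id + 1, fun h => by
        have := Finset.le_sup (f := id) h
        simp only [id] at this
        omega, by omega⟩
    apply hgt j hj.2
    rw [hs, map_sum]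
    refine Finset.sum_eq_zero (fun i hi => ?_)
    rw [← HH_comp_apply, inj_cproj_ne _ i j (fun h => hj.1 (h ▸ hi)), HH_zero_apply]
  · intro x
    obtain ⟨y, rfl⟩ := hepi x
    obtain ⟨s, hs⟩ := D_span hc n y
    change _ ∈ LinearMap.range _
    rw [hs, map_sum]
    refine Submodule.sum_mem _ (fun i _ => ?_)
    rw [← HH_comp_apply]
    generalize ((HH n).map (cproj hc i)).hom y = z
    rcases le_total i N with hi | hi
    · rw [← inj_comp_pi hc π hz i N hi, HH_comp_apply]
      exact ⟨_, rfl⟩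
    · obtain ⟨w, rfl⟩ := ((HH_iso_bij _ _).mp (isIso_map_le n N hN i hi)).2 z
      rw [← HH_comp_apply, inj_comp_pi hc π hz N i hi]
      exact ⟨_, rfl⟩
end hocolim
end derived

section perf
variable {Λ : Type u} [Ring Λ] [HasDerivedCategory (ModuleCat.{u} Λ)]
open DerivedCategory

lemma fp_of_perfect (hcoh : ∀ I : Submodule Λ Λ, I.FG → Module.FinitePresentation Λ I)
    {X : DerivedCategory (ModuleCat.{u} Λ)} (hX : IsPerfectObj Λ X) (n : ℤ) :
    Module.FinitePresentation Λ ((HH n).obj X) := by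
  obtain ⟨P, hP, -, ⟨e⟩⟩ := hX
  have h1 : Module.FinitePresentation Λ (P.sc n).homology := by
    have a : Module.Finite Λ (P.sc n).X₁ := (hP _).1
    have b : Module.Finite Λ (P.sc n).X₂ := (hP _).1
    have c : Module.Finite Λ (P.sc n).X₃ := (hP _).1
    have b : Module.Projective Λ (P.sc n).X₂ := (hP _).2
    have c : Module.Projective Λ (P.sc n).X₃ := (hP _).2
    exact coh_homology hcoh _
  have e1 : (P.sc n).homology ≅ (HH n).obj X :=
    ((homologyFunctorFactors (ModuleCat.{u} Λ) n).app P).symm ≪≫ (HH n).mapIso e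
  exact Module.FinitePresentation.of_equiv e1.toLinearEquiv

lemma forward (hcoh : ∀ I : Submodule Λ Λ, I.FG → Module.FinitePresentation Λ I)
    (X : DerivedCategory (ModuleCat.{u} Λ)) (h : HomologicallyPerfect Λ X) :
      ((∀ n : ℤ, Module.FinitePresentation Λ
          ((DerivedCategory.homologyFunctor (ModuleCat.{u} Λ) n).obj X)) ∧
        ∃ N : ℕ, ∀ n : ℤ, (N : ℤ) ≤ |n| →
          Limits.IsZero ((DerivedCategory.homologyFunctor (ModuleCat.{u} Λ) n).obj X)) := by
  obtain ⟨Xs, hp, c, hc, π, δ, hT, -, h2, M, h3⟩ := h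
  refine ⟨fun n => ?_, M, fun n hn => ?_⟩
  · obtain ⟨N, hN⟩ := h2 n
    have := hocolim_isIso hc π δ hT n N hN
    have := fp_of_perfect hcoh (hp N) n
    exact Module.FinitePresentation.of_equiv (asIso ((HH n).map (c.inj N ≫ π))).toLinearEquiv
  · obtain ⟨N, hN⟩ := h2 n
    obtain ⟨N', hN'⟩ := h3 n hn
    have := hocolim_isIso hc π δ hT n (max N N') (fun i hi => hN i (by omega))
    exact (hN' (max N N') (by omega)).of_iso (asIso ((HH n).map (c.inj _ ≫ π))).symm

end perf

section perf
variable {Λ : Type u} [Ring Λ] [HasDerivedCategory (ModuleCat.{u} Λ)]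
open DerivedCategory

lemma perfect_iso {X Y : DerivedCategory (ModuleCat.{u} Λ)} (e : X ≅ Y) (hX : IsPerfectObj Λ X) :
    IsPerfectObj Λ Y := by
  obtain ⟨P, h1, h2, ⟨e'⟩⟩ := hX
  exact ⟨P, h1, h2, ⟨e' ≪≫ e⟩⟩

lemma perfect_shift {X : DerivedCategory (ModuleCat.{u} Λ)} (hX : IsPerfectObj Λ X) (k : ℤ) :
    IsPerfectObj Λ (X⟦k⟧) := by
  obtain ⟨P, h1, ⟨N, h2⟩, ⟨e⟩⟩ := hX
  refine ⟨P⟦k⟧, fun n => h1 (n + k), ⟨N + k.natAbs, fun n hn => h2 (n + k) ?_⟩,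
    ⟨(Q.commShiftIso k).app P ≪≫ (shiftFunctor _ k).mapIso e⟩⟩
  push_cast at hn
  have : |n| ≤ |n + k| + |k| := by
    have := abs_sub (n + k) k
    simpa using this
  omega

lemma perfect_kproj (P : CochainComplex (ModuleCat.{u} Λ) ℤ)
    (h1 : ∀ n : ℤ, Module.Finite Λ (P.X n) ∧ Module.Projective Λ (P.X n))
    (N : ℕ) (h2 : ∀ n : ℤ, (N : ℤ) ≤ |n| → Limits.IsZero (P.X n)) : P.IsKProjective := by
  have : P.IsStrictlyLE N := by
    rw [CochainComplex.isStrictlyLE_iff]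
    intro i hi
    exact h2 i (hi.le.trans (le_abs_self i))
  have (n : ℤ) : Projective (P.X n) := by
    have := (h1 n).2
    exact (IsProjective.iff_projective (P.X n)).mp this
  exact CochainComplex.isKProjective_of_projective P N

lemma exists_lift (P L : CochainComplex (ModuleCat.{u} Λ) ℤ) [P.IsKProjective]
    (f : Q.obj P ⟶ Q.obj L) : ∃ φ : P ⟶ L, Q.map φ = f := by
  obtain ⟨g, hg⟩ := (CochainComplex.IsKProjective.Qh_map_bijective P
    ((HomotopyCategory.quotient _ _).obj L)).2
      ((quotientCompQhIso _).hom.app P ≫ f ≫ (quotientCompQhIso _).inv.app L)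
  obtain ⟨φ, rfl⟩ := (HomotopyCategory.quotient _ _).map_surjective g
  refine ⟨φ, ?_⟩
  rw [← cancel_mono ((quotientCompQhIso _).inv.app L), quotientCompQhIso_inv_naturality, hg]
  exact Iso.inv_hom_id_app_assoc _ _ _

lemma perfect_cone {X Y Z : DerivedCategory (ModuleCat.{u} Λ)} {f : X ⟶ Y} {g : Y ⟶ Z}
    {h : Z ⟶ X⟦(1 : ℤ)⟧} (hT : Triangle.mk f g h ∈ distTriang (DerivedCategory (ModuleCat.{u} Λ)))
    (hX : IsPerfectObj Λ X) (hY : IsPerfectObj Λ Y) : IsPerfectObj Λ Z := by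
  obtain ⟨P, hP1, ⟨N, hP2⟩, ⟨e⟩⟩ := hX
  obtain ⟨R, hR1, ⟨M, hR2⟩, ⟨e'⟩⟩ := hY
  have := perfect_kproj P hP1 N hP2
  obtain ⟨φ, hφ⟩ := exists_lift P R (e.hom ≫ f ≫ e'.inv)
  have hT' := DerivedCategory.mappingCone_triangle_distinguished φ
  let E := isoTriangleOfIso₁₂ _ _ hT' hT e e' (by
    change Q.map φ ≫ e'.hom = e.hom ≫ f
    rw [hφ]; simp)
  refine ⟨CochainComplex.mappingCone φ, fun n => ?_, ⟨N + M + 1, fun n hn => ?_⟩,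
    ⟨(Triangle.π₃.mapIso E)⟩⟩
  · have e2 : (CochainComplex.mappingCone φ).X n ≅ ModuleCat.of Λ (P.X (n+1) × R.X n) :=
      HomologicalComplex.homotopyCofiber.XIsoBiprod φ n (n + 1) rfl ≪≫ ModuleCat.biprodIsoProd _ _
    have := (hP1 (n+1)).1
    have := (hP1 (n+1)).2
    have := (hR1 n).1
    have := (hR1 n).2
    constructor
    · exact Module.Finite.equiv e2.toLinearEquiv.symm
    · exact Module.Projective.of_equiv e2.toLinearEquiv.symm
  · rw [CochainComplex.mappingCone.isZero_X_iff]
    have : |n| ≤ |n + 1| + |1| := by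
      have := abs_sub (n + 1) 1
      simpa using this
    push_cast at hn
    rw [abs_one] at this
    exact ⟨hP2 _ (by omega), hR2 _ (by omega)⟩

lemma hom_zero (C : DerivedCategory (ModuleCat.{u} Λ)) (hC : IsPerfectObj Λ C) :
    ∃ N : ℕ, ∀ (Y : DerivedCategory (ModuleCat.{u} Λ)),
      (∀ n : ℤ, -N < n → IsZero ((HH n).obj Y)) → ∀ f : C ⟶ Y, f = 0 := by
  obtain ⟨P, hP1, ⟨N, hP2⟩, ⟨e⟩⟩ := hC
  refine ⟨N, fun Y hY f => ?_⟩
  have := perfect_kproj P hP1 N hP2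
  have : Y.IsLE (-N) := (isLE_iff _ _).mpr hY
  obtain ⟨L, hL, ⟨e'⟩⟩ := exists_iso_Q_obj_of_isLE Y (-N)
  obtain ⟨φ, hφ⟩ := exists_lift P L (e.hom ≫ f ≫ e'.hom)
  have : φ = 0 := by
    ext1 n
    by_cases h : (N : ℤ) ≤ |n|
    · exact (hP2 n h).eq_of_src _ _
    · refine (L.isZero_of_isStrictlyLE (-N) n ?_).eq_of_tgt _ _
      rw [not_le, abs_lt] at h
      exact h.1
  rw [this, Functor.map_zero] at hφ
  rw [← cancel_epi e.hom, ← cancel_mono e'.hom, Category.assoc, ← hφ]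
  simp

lemma perfect_single (M : ModuleCat.{u} Λ) [Module.Finite Λ M] [Module.Projective Λ M] (d : ℤ) :
    IsPerfectObj Λ (Q.obj ((HomologicalComplex.single (ModuleCat.{u} Λ) (.up ℤ) d).obj M)) := by
  refine ⟨_, fun n => ?_, ⟨d.natAbs + 1, fun n hn => ?_⟩, ⟨Iso.refl _⟩⟩
  · by_cases h : n = d
    · subst h
      let e := (HomologicalComplex.singleObjXSelf (.up ℤ) n M).toLinearEquiv
      exact ⟨Module.Finite.equiv e.symm, Module.Projective.of_equiv e.symm⟩
    · have := HomologicalComplex.isZero_single_obj_X (.up ℤ) d M n h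
      have := ModuleCat.subsingleton_of_isZero this
      exact ⟨inferInstance, inferInstance⟩
  · refine HomologicalComplex.isZero_single_obj_X (.up ℤ) d M n ?_
    rintro rfl
    push_cast at hn
    omega

lemma single_HH_zero (M : ModuleCat.{u} Λ) (d n : ℤ) (h : n ≠ d) :
    IsZero ((HH n).obj (Q.obj ((HomologicalComplex.single (ModuleCat.{u} Λ) (.up ℤ) d).obj M))) :=
  (HomologicalComplex.isZero_single_obj_homology (.up ℤ) d M n h).of_iso
    ((homologyFunctorFactors (ModuleCat.{u} Λ) n).app _)

lemma realize (C : DerivedCategory (ModuleCat.{u} Λ)) (d : ℤ) (M : ModuleCat.{u} Λ)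
    [Module.Projective Λ M] (α : M ⟶ (HH d).obj C) (hα : Function.Surjective α.hom) :
    ∃ f : Q.obj ((HomologicalComplex.single (ModuleCat.{u} Λ) (.up ℤ) d).obj M) ⟶ C,
      Function.Surjective ((HH d).map f).hom := by
  let L := Q.objPreimage C
  let e : Q.obj L ≅ C := Q.objObjPreimageIso C
  let E : (HH d).obj C ≅ L.homology d :=
    (HH d).mapIso e.symm ≪≫ (homologyFunctorFactors (ModuleCat.{u} Λ) d).app L
  let α' : M ⟶ L.homology d := α ≫ E.hom
  have : Projective M := (IsProjective.iff_projective M).mp inferInstance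
  let β : M ⟶ L.cycles d := Projective.factorThru α' (L.homologyπ d)
  have hβ : β ≫ L.homologyπ d = α' := Projective.factorThru_comp _ _
  let φ : (HomologicalComplex.single (ModuleCat.{u} Λ) (.up ℤ) d).obj M ⟶ L :=
    HomologicalComplex.mkHomFromSingle (β ≫ L.iCycles d) (fun k _ => by simp)
  have hφ : (HomologicalComplex.singleObjCyclesSelfIso (.up ℤ) d M).inv ≫
      HomologicalComplex.cyclesMap φ d = β := by
    rw [← cancel_mono (L.iCycles d)]
    simp [φ]
  have hφ2 : (HomologicalComplex.singleObjCyclesSelfIso (.up ℤ) d M).inv ≫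
      HomologicalComplex.homologyπ _ d ≫ HomologicalComplex.homologyMap φ d = α' := by
    rw [HomologicalComplex.homologyπ_naturality, reassoc_of% hφ, hβ]
  have hα' : Epi α' := by
    have : Epi α := (ModuleCat.epi_iff_surjective _).mpr hα
    exact epi_comp _ _
  have hep : Epi (HomologicalComplex.homologyMap φ d) := by
    rw [← hφ2, ← Category.assoc] at hα'
    exact @epi_of_epi _ _ _ _ _ _ _ hα'
  refine ⟨Q.map φ ≫ e.hom, ?_⟩
  refine (ModuleCat.epi_iff_surjective _).mp ?_
  have h3 := homologyFunctorFactors_hom_naturality φ d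
  have : Epi ((HH d).map (Q.map φ)) := by
    have : Epi ((HH d).map (Q.map φ) ≫ ((homologyFunctorFactors (ModuleCat.{u} Λ) d).app L).hom) := by
      refine h3.symm ▸ ?_
      exact @epi_comp _ _ _ _ _ _ inferInstance _ hep
    exact (epi_comp_iff_of_isIso _ ((homologyFunctorFactors (ModuleCat.{u} Λ) d).app L).hom).mp this
  rw [Functor.map_comp]
  infer_instance

end perf

section step
variable {Λ : Type u} [Ring Λ] [HasDerivedCategory (ModuleCat.{u} Λ)]
open DerivedCategory

lemma dl_comp {X Y Z Y' Z' : DerivedCategory (ModuleCat.{u} Λ)} (f : X ⟶ Y) (g : Y ⟶ Z)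
    (h : Z ⟶ X⟦(1 : ℤ)⟧) (f' : X ⟶ Y') (g' : Y' ⟶ Z') (v : Z' ⟶ Z) (n m : ℤ) (hnm : n + 1 = m)
    (z : (HH n).obj Z') :
    (dl f' g' (v ≫ h) n m hnm).hom z = (dl f g h n m hnm).hom (((HH n).map v).hom z) :=
  congrArg (fun k => k.hom z) ((homologyFunctor (ModuleCat.{u} Λ) 0).shiftMap_comp' v h n m
    (by rw [add_comm 1, hnm]))

lemma zero_elt {M : ModuleCat.{u} Λ} (h : IsZero M) (x : M) : x = 0 := by
  have := ModuleCat.subsingleton_of_isZero h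
  exact Subsingleton.elim _ _

/-- partial resolution -/
structure Good (X Y : DerivedCategory (ModuleCat.{u} Λ)) (f : Y ⟶ X) (d : ℤ) : Prop where
  perf : IsPerfectObj Λ Y
  inj : ∀ n, d < n → ∀ y : (HH n).obj Y, ((HH n).map f).hom y = 0 → y = 0
  surj : ∀ n, d ≤ n → Function.Surjective ((HH n).map f).hom

/-- the cone of a transition -/
def Trans {Y Y' : DerivedCategory (ModuleCat.{u} Λ)} (t : Y ⟶ Y') (d : ℤ) : Prop :=
  ∃ (F : DerivedCategory (ModuleCat.{u} Λ)) (p : Y' ⟶ F) (q : F ⟶ Y⟦(1 : ℤ)⟧),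
    Triangle.mk t p q ∈ distTriang (DerivedCategory (ModuleCat.{u} Λ)) ∧
    ∀ n, n ≠ d → IsZero ((HH n).obj F)

lemma Trans.isIso {Y Y' : DerivedCategory (ModuleCat.{u} Λ)} {t : Y ⟶ Y'} {d : ℤ}
    (h : Trans t d) (n : ℤ) (h1 : n < d ∨ d + 1 < n) : IsIso ((HH n).map t) := by
  obtain ⟨F, p, q, hT, hF⟩ := h
  rw [HH_iso_bij]
  constructor
  · rw [injective_iff_map_eq_zero]
    intro y hy
    obtain ⟨z, hz⟩ := les1 hT (n-1) n (by omega) y hy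
    rw [← hz, zero_elt (hF (n-1) (by omega)) z, map_zero]
  · intro y
    exact les2 hT n y (zero_elt (hF n (by omega)) _)

lemma Trans.hom_bij {Y Y' C : DerivedCategory (ModuleCat.{u} Λ)} {t : Y ⟶ Y'} {d : ℤ}
    (h : Trans t d) (N N' : ℕ)
    (h1 : ∀ (Z : DerivedCategory (ModuleCat.{u} Λ)),
      (∀ n : ℤ, -N < n → IsZero ((HH n).obj Z)) → ∀ f : C ⟶ Z, f = 0)
    (h2 : ∀ (Z : DerivedCategory (ModuleCat.{u} Λ)),
      (∀ n : ℤ, -N' < n → IsZero ((HH n).obj Z)) → ∀ f : C⟦(1 : ℤ)⟧ ⟶ Z, f = 0)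
    (hd : d ≤ -N) (hd' : d ≤ -N') :
    Function.Bijective (fun g : C ⟶ Y => g ≫ t) := by
  obtain ⟨F, p, q, hT, hF⟩ := h
  have k1 := h1 F (fun n hn => hF n (by omega))
  have k2 := h2 F (fun n hn => hF n (by omega))
  constructor
  · intro a b hab
    dsimp only at hab
    rw [← sub_eq_zero] at hab ⊢
    rw [← Preadditive.sub_comp] at hab
    apply (shiftFunctor (DerivedCategory (ModuleCat.{u} Λ)) (1 : ℤ)).map_injective
    obtain ⟨g, hg⟩ := Triangle.coyoneda_exact₁ _ hT ((a - b)⟦(1 : ℤ)⟧') (by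
      change (a - b)⟦(1 : ℤ)⟧' ≫ t⟦(1 : ℤ)⟧' = 0
      rw [← Functor.map_comp, hab, Functor.map_zero])
    have hg0 : g = 0 := k2 g
    rw [hg0, Limits.zero_comp] at hg
    exact hg.trans (Functor.map_zero _ _ _).symm
  · intro b
    obtain ⟨g, hg⟩ := Triangle.coyoneda_exact₂ _ hT b (k1 _)
    exact ⟨g, hg.symm⟩

lemma step (hcoh : ∀ I : Submodule Λ Λ, I.FG → Module.FinitePresentation Λ I)
    {X Y : DerivedCategory (ModuleCat.{u} Λ)}
    (hX : ∀ n : ℤ, Module.FinitePresentation Λ ((HH n).obj X)) (f : Y ⟶ X) (d d' : ℤ)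
    (hd : d' + 1 = d) (h : Good X Y f d) :
    ∃ (Y' : DerivedCategory (ModuleCat.{u} Λ)) (f' : Y' ⟶ X) (t : Y ⟶ Y'),
      Good X Y' f' d' ∧ t ≫ f' = f ∧ Trans t d' := by
  obtain ⟨C, u, w, hT⟩ := distinguished_cocone_triangle f
  have fgC : Module.Finite Λ ((HH d').obj C) := by
    have := fp_of_perfect hcoh h.perf d
    have := hX d
    have := hX d'
    have hk := Module.FinitePresentation.fg_ker ((HH d).map f).hom (h.surj d le_rfl)
    refine ⟨Submodule.fg_of_fg_map_of_fg_inf_ker (dl f u w d' d hd).hom ?_ ?_⟩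
    · convert hk
      ext y
      constructor
      · rintro ⟨z, -, rfl⟩
        exact les_z1 hT _ _ _ _
      · intro hy
        obtain ⟨z, hz⟩ := les1 hT d' d hd y hy
        exact ⟨z, trivial, hz⟩
    · have hr : (LinearMap.range ((HH d').map u).hom).FG :=
        Module.Finite.iff_fg.mp inferInstance
      convert hr
      ext z
      constructor
      · rintro ⟨-, hz⟩
        exact les3 hT d' d hd z hz
      · rintro ⟨x, rfl⟩
        exact ⟨trivial, les_z3 hT _ _ _ _⟩
  obtain ⟨m, α, hα⟩ := Module.Finite.exists_fin' Λ ((HH d').obj C)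
  obtain ⟨v, hv⟩ := realize C d' (ModuleCat.of Λ (Fin m → Λ)) (ModuleCat.ofHom α) hα
  have hFp := perfect_single (ModuleCat.of Λ (Fin m → Λ)) d'
  have hF0 := fun n => single_HH_zero (ModuleCat.of Λ (Fin m → Λ)) d' n
  generalize Q.obj ((HomologicalComplex.single (ModuleCat.{u} Λ) (.up ℤ) d').obj
    (ModuleCat.of Λ (Fin m → Λ))) = F at v hv hFp hF0
  obtain ⟨Y', t, p, hT'⟩ := distinguished_cocone_triangle₂ (v ≫ w)
  obtain ⟨f', hf1, hf2⟩ := complete_distinguished_triangle_morphism₂ _ _ hT' hT (𝟙 Y) v (by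
    change (v ≫ w) ≫ (𝟙 Y)⟦(1 : ℤ)⟧' = v ≫ w
    rw [CategoryTheory.Functor.map_id, Category.comp_id])
  change Y' ⟶ X at f'
  change t ≫ f' = 𝟙 Y ≫ f at hf1
  change p ≫ v = f' ≫ u at hf2
  rw [Category.id_comp] at hf1
  refine ⟨Y', f', t, ⟨?_, ?_, ?_⟩, hf1, F, p, v ≫ w, hT', hF0⟩
  · exact perfect_cone (inv_rot_of_distTriang _ hT') (perfect_shift hFp (-1)) h.perf
  · intro n hn y' hy'
    obtain ⟨y, rfl⟩ := les2 hT' n y' (zero_elt (hF0 n (by omega)) _)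
    rw [← HH_comp_apply, hf1] at hy'
    by_cases hnd : d < n
    · rw [h.inj n hnd y hy', map_zero]
    · obtain rfl : n = d := by omega
      obtain ⟨z, rfl⟩ := les1 hT d' n hd y hy'
      obtain ⟨z', rfl⟩ := hv z
      rw [← dl_comp f u w t p v]
      exact les_z1 hT' _ _ _ _
  · intro n hn x
    by_cases hnd : d ≤ n
    · obtain ⟨y, rfl⟩ := h.surj n hnd x
      exact ⟨((HH n).map t).hom y, by rw [← HH_comp_apply, hf1]⟩
    · obtain rfl : n = d' := by omega
      obtain ⟨z, hz⟩ := hv (((HH n).map u).hom x)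
      obtain ⟨y', rfl⟩ := les3 hT' n d hd z (by
        rw [dl_comp f u w t p v, hz]
        exact les_z3 hT _ _ _ _)
      obtain ⟨y, hy⟩ := les2 hT n (x - ((HH n).map f').hom y') (by
        rw [map_sub, ← hz, ← HH_comp_apply, ← HH_comp_apply, hf2, sub_self])
      refine ⟨((HH n).map t).hom y + y', ?_⟩
      rw [map_add, ← HH_comp_apply, hf1, hy, sub_add_cancel]

lemma exists_seq (hcoh : ∀ I : Submodule Λ Λ, I.FG → Module.FinitePresentation Λ I)
    {X : DerivedCategory (ModuleCat.{u} Λ)}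
    (hX : ∀ n : ℤ, Module.FinitePresentation Λ ((HH n).obj X)) (N : ℕ)
    (hN : ∀ n : ℤ, (N : ℤ) ≤ |n| → IsZero ((HH n).obj X)) :
    ∃ (Xs : ℕ ⥤ DerivedCategory (ModuleCat.{u} Λ)) (f : ∀ i, Xs.obj i ⟶ X),
      (∀ i, Good X (Xs.obj i) (f i) (N - i)) ∧
      (∀ i, Xs.map (homOfLE (Nat.le_succ i)) ≫ f (i + 1) = f i) ∧
      (∀ i, Trans (Xs.map (homOfLE (Nat.le_succ i))) (N - i - 1)) := by
  let S (i : ℕ) := {p : (Y : DerivedCategory (ModuleCat.{u} Λ)) × (Y ⟶ X) // Good X p.1 p.2 (N - i)}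
  have h0 : Nonempty (S 0) := by
    refine ⟨⟨⟨_, (0 : Q.obj ((HomologicalComplex.single (ModuleCat.{u} Λ) (.up ℤ) (N - 1)).obj
      (ModuleCat.of Λ PUnit)) ⟶ X)⟩, perfect_single _ _, fun n hn y _ => ?_, fun n hn x => ?_⟩⟩
    · exact zero_elt (single_HH_zero _ _ _ (by omega)) y
    · exact ⟨0, (zero_elt (hN n (by rw [abs_of_nonneg] <;> omega)) _).trans
        (zero_elt (hN n (by rw [abs_of_nonneg] <;> omega)) _).symm⟩
  have hs (i : ℕ) (s : S i) : ∃ (s' : S (i + 1)) (t : s.1.1 ⟶ s'.1.1),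
      t ≫ s'.1.2 = s.1.2 ∧ Trans t (N - i - 1) := by
    obtain ⟨Y', f', t, h1, h2, h3⟩ := step hcoh hX s.1.2 (N - i) (N - i - 1) (by omega) s.2
    exact ⟨⟨⟨Y', f'⟩, by convert! h1 using 1; push_cast; omega⟩, t, h2, h3⟩
  choose nx t ht1 ht2 using hs
  let s (i : ℕ) : S i := Nat.rec (Classical.choice h0) nx i
  let tt (i : ℕ) : (s i).1.1 ⟶ (s (i+1)).1.1 := t i (s i)
  have e (i : ℕ) : (Functor.ofSequence tt).map (homOfLE (Nat.le_succ i)) = tt i :=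
    Functor.ofSequence_map_homOfLE_succ tt i
  refine ⟨Functor.ofSequence tt, fun i => (s i).1.2, fun i => (s i).2, fun i => ?_, fun i => ?_⟩
  · rw [e]; exact ht1 i (s i)
  · rw [e]; exact ht2 i (s i)

lemma backward (hcoh : ∀ I : Submodule Λ Λ, I.FG → Module.FinitePresentation Λ I)
    {X : DerivedCategory (ModuleCat.{u} Λ)}
    (hX : ∀ n : ℤ, Module.FinitePresentation Λ ((HH n).obj X)) (N : ℕ)
    (hN : ∀ n : ℤ, (N : ℤ) ≤ |n| → IsZero ((HH n).obj X)) : HomologicallyPerfect Λ X := by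
  obtain ⟨Xs, f, hg, hf, ht⟩ := exists_seq hcoh hX N hN
  obtain ⟨c, hc, -⟩ := exists_coprod Xs.obj
  obtain ⟨X', π, δ, hT⟩ := distinguished_cocone_triangle (oneSubShiftCofan Xs c hc)
  let F : c.pt ⟶ X := Cofan.IsColimit.desc hc f
  have hF (i) : c.inj i ≫ F = f i := Cofan.IsColimit.fac _ _ _
  have hF0 : oneSubShiftCofan Xs c hc ≫ F = 0 := by
    refine Cofan.IsColimit.hom_ext hc _ _ (fun i => ?_)
    rw [inj_oneSub_assoc, Preadditive.sub_comp, Category.assoc, hF, hF, hf, sub_self, comp_zero]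
  obtain ⟨k, hk⟩ := Triangle.yoneda_exact₂ _ hT F hF0
  change X' ⟶ X at k
  change F = π ≫ k at hk
  have hiso (n : ℤ) (i : ℕ) (hi : (N : ℤ) - i < n) : IsIso ((HH n).map (f i)) := by
    rw [HH_iso_bij]
    exact ⟨(injective_iff_map_eq_zero _).mpr ((hg i).inj n hi), (hg i).surj n hi.le⟩
  have hstab (n : ℤ) : ∃ M : ℕ, (N : ℤ) - M < n ∧ ∀ i : ℕ, M ≤ i →
      IsIso ((HH n).map (Xs.map (homOfLE (Nat.le_succ i)))) := by
    refine ⟨N + n.natAbs + 1, by omega, fun i hi => (ht i).isIso n ?_⟩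
    right; omega
  have hkiso : IsIso k := by
    rw [DerivedCategory.isIso_iff]
    intro n
    obtain ⟨M, hM1, hM⟩ := hstab n
    have h1 := hocolim_isIso hc π δ hT n M hM
    have h2 := hiso n M hM1
    rw [← hF, hk, ← Category.assoc, Functor.map_comp] at h2
    exact @IsIso.of_isIso_comp_left _ _ _ _ _ _ _ h1 h2
  refine ⟨Xs, fun i => (hg i).perf, c, hc, π ≫ k, inv k ≫ δ, ?_, ?_, ?_, N, ?_⟩
  · refine isomorphic_distinguished _ hT _ ?_
    exact Triangle.isoMk _ _ (Iso.refl _) (Iso.refl _) (asIso k).symm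
      (((Category.comp_id _).trans (Category.id_comp _).symm :
        oneSubShiftCofan Xs c hc ≫ 𝟙 c.pt = 𝟙 c.pt ≫ oneSubShiftCofan Xs c hc))
      (show (π ≫ k) ≫ inv k = 𝟙 c.pt ≫ π by simp)
      (show (inv k ≫ δ) ≫ (𝟙 c.pt)⟦(1 : ℤ)⟧' = inv k ≫ δ by
        rw [CategoryTheory.Functor.map_id, Category.comp_id])
  · intro C hC
    obtain ⟨M, hM⟩ := hom_zero C hC
    obtain ⟨M', hM'⟩ := hom_zero _ (perfect_shift hC 1)
    exact ⟨N + M + M', fun i hi => (ht i).hom_bij M M' hM hM' (by omega) (by omega)⟩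
  · intro n
    obtain ⟨M, -, hM⟩ := hstab n
    exact ⟨M, hM⟩
  · intro n hn
    refine ⟨N + n.natAbs + 1, fun i hi => ?_⟩
    have := hiso n i (by omega)
    exact (hN n hn).of_iso (asIso ((HH n).map (f i)))

end step

theorem homologicallyPerfect_iff_bounded_finitelyPresented_cohomology
    (hcoh : ∀ I : Submodule Λ Λ, I.FG → Module.FinitePresentation Λ I)
    (X : DerivedCategory (ModuleCat.{u} Λ)) :
    HomologicallyPerfect Λ X ↔
      ((∀ n : ℤ, Module.FinitePresentation Λ
          ((DerivedCategory.homologyFunctor (ModuleCat.{u} Λ) n).obj X)) ∧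
        ∃ N : ℕ, ∀ n : ℤ, (N : ℤ) ≤ |n| →
          Limits.IsZero ((DerivedCategory.homologyFunctor (ModuleCat.{u} Λ) n).obj X)) := by
  exact ⟨forward hcoh X, fun ⟨h, N, hN⟩ => backward hcoh h N hN⟩

end SeqCompletion
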